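/- The squared Cramér distance is jointly convex under finite mixtures: let ι be a finite index set, let w : ι → ℝ satisfy w_i ≥ 0 and ∑_i w_i = 1, and let P_i, Q_i (i ∈ ι) be Borel probability measures on ℝ. Then ℓ₂²(∑_i w_i P_i, ∑_i w_i Q_i) ≤ ∑_i w_i · ℓ₂²(P_i, Q_i), where ∑_i w_i P_i denotes the mixture measure with weights w_i. -/

import Mathlib

open MeasureTheory

/-- Cumulative distribution function of a Borel measure on ℝ. -/
noncomputable def cdf (P : Measure ℝ) (x : ℝ) : ℝ := (P (Set.Iic x)).toReal

/-- Squared Cramér distance, valued in `[0,∞]`. -/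
noncomputable def cramerSq (P Q : Measure ℝ) : ENNReal :=
  ∫⁻ x, ENNReal.ofReal ((cdf P x - cdf Q x) ^ 2)

/-- Cramér distance, valued in `[0,∞]`. -/
noncomputable def cramer (P Q : Measure ℝ) : ENNReal :=
  cramerSq P Q ^ (1 / 2 : ℝ)

theorem measurable_cdf_of_isFiniteMeasure (P : Measure ℝ) [IsFiniteMeasure P] :
    Measurable (cdf P) :=
  Monotone.measurable fun _ _ hxy =>
    ENNReal.toReal_mono (measure_ne_top P _) (measure_mono (Set.Iic_subset_Iic.2 hxy))

theorem cdf_finsetSum_smul {ι : Type*} (s : Finset ι) (w : ι → ℝ) (hw : ∀ i ∈ s, 0 ≤ w i)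
    (P : ι → Measure ℝ) [∀ i, IsFiniteMeasure (P i)] (x : ℝ) :
    cdf (∑ i ∈ s, ENNReal.ofReal (w i) • P i) x = ∑ i ∈ s, w i * cdf (P i) x := by
  simp only [cdf, Measure.coe_finsetSum, Finset.sum_apply, Measure.smul_apply, smul_eq_mul]
  rw [ENNReal.toReal_sum fun i _ => ENNReal.mul_ne_top ENNReal.ofReal_ne_top (measure_ne_top _ _)]
  refine Finset.sum_congr rfl fun i hi => ?_
  rw [ENNReal.toReal_mul, ENNReal.toReal_ofReal (hw i hi)]

/-- The squared Cramér distance is jointly convex under finite mixtures. -/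
theorem cramerSq_mixture_convex {ι : Type*} [Fintype ι]
    (w : ι → ℝ) (hw : ∀ i, 0 ≤ w i) (hsum : ∑ i, w i = 1)
    (P Q : ι → Measure ℝ)
    [∀ i, IsProbabilityMeasure (P i)] [∀ i, IsProbabilityMeasure (Q i)] :
    cramerSq (∑ i, ENNReal.ofReal (w i) • P i) (∑ i, ENNReal.ofReal (w i) • Q i)
      ≤ ∑ i, ENNReal.ofReal (w i) * cramerSq (P i) (Q i) := by
  have hmeas (i : ι) : Measurable fun x => ENNReal.ofReal ((cdf (P i) x - cdf (Q i) x) ^ 2) :=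
    (((measurable_cdf_of_isFiniteMeasure (P i)).sub
      (measurable_cdf_of_isFiniteMeasure (Q i))).pow_const 2).ennreal_ofReal
  unfold cramerSq
  simp_rw [← lintegral_const_mul _ (hmeas _)]
  rw [← lintegral_finsetSum _ fun i _ => (hmeas i).const_mul _]
  refine lintegral_mono fun x => ?_
  simp_rw [← ENNReal.ofReal_mul (hw _)]
  rw [← ENNReal.ofReal_sum_of_nonneg fun i _ => mul_nonneg (hw i) (sq_nonneg _)]
  refine ENNReal.ofReal_le_ofReal ?_
  rw [cdf_finsetSum_smul _ w (fun i _ => hw i), cdf_finsetSum_smul _ w (fun i _ => hw i),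
    ← Finset.sum_sub_distrib]
  simp_rw [← mul_sub]
  exact Real.pow_arith_mean_le_arith_mean_pow_of_even _ w _ (fun i _ => hw i) hsum even_two
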